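/- Let φ : ℝ² → [0,1] be smooth, equal to 1 on the ball B(0, 3/4) and supported in B(0, 3/2), and for k ∈ ℤ set φ_k(ξ) = φ(2^{−k}ξ) − φ(2^{−k+1}ξ). There is a constant C = C(φ) such that for all integers k₁, k₂, k₃ ∈ ℤ and all signs μ, ν ∈ {+1, −1}: (a) ∫_{ℝ⁴} |𝓕[ (ξ₁, ξ₂) ↦ φ_{k₃}(ξ₁+ξ₂) · Φ_{μν}(ξ₁, ξ₂)^{−1} · φ_{k₁}(ξ₁) φ_{k₂}(ξ₂) ](z)| dz ≤ C · 2^{−min(k₁,k₂,k₃)/2}; (b) if moreover k₁ ≤ k₂ − 3 and ν = −1, then the same integral is at most C · 2^{−k₂/2}. (Each bracketed function is supported where ξ₁, ξ₂ and ξ₁+ξ₂ are all nonzero, where Φ_{μν} is nonvanishing, and is extended by 0 elsewhere; 𝓕 is the Fourier transform on ℝ⁴ ≅ ℝ² × ℝ².) -/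

import Mathlib

open MeasureTheory Complex
open scoped RealInnerProductSpace

noncomputable section

/-- The Fourier transform on `ℝ⁴ ≅ ℝ² × ℝ²`: `𝓕F(z) = ∫ e^{−i z·ζ} F(ζ) dζ`. -/
def FT4 (F : EuclideanSpace ℝ (Fin 2) × EuclideanSpace ℝ (Fin 2) → ℂ)
    (z : EuclideanSpace ℝ (Fin 2) × EuclideanSpace ℝ (Fin 2)) : ℂ :=
  ∫ ζ : EuclideanSpace ℝ (Fin 2) × EuclideanSpace ℝ (Fin 2),
    Complex.exp (-(Complex.I * ((⟪z.1, ζ.1⟫ + ⟪z.2, ζ.2⟫ : ℝ) : ℂ))) * F ζ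

/-- The Littlewood–Paley cutoff `φ_k(ξ) = φ(2^{−k}ξ) − φ(2^{−k+1}ξ)`. -/
def LPcut (φ : EuclideanSpace ℝ (Fin 2) → ℝ) (k : ℤ) (ξ : EuclideanSpace ℝ (Fin 2)) : ℝ :=
  φ ((2 : ℝ) ^ (-k) • ξ) - φ ((2 : ℝ) ^ (-k + 1) • ξ)

/-- The phase `Φ_{μν}(ξ₁,ξ₂) = ‖ξ₁+ξ₂‖^{1/2} − μ‖ξ₁‖^{1/2} − ν‖ξ₂‖^{1/2}` associated with
the dispersion relation `Λ(ξ) = ‖ξ‖^{1/2}` of the gravity water wave equation. -/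
def PhiGWW (μ ν : ℝ) (p : EuclideanSpace ℝ (Fin 2) × EuclideanSpace ℝ (Fin 2)) : ℝ :=
  Real.sqrt ‖p.1 + p.2‖ - μ * Real.sqrt ‖p.1‖ - ν * Real.sqrt ‖p.2‖

local notation "ℝ²" => EuclideanSpace ℝ (Fin 2)

instance : (volume : Measure (ℝ² × ℝ²)).IsAddHaarMeasure :=
  inferInstanceAs ((volume : Measure ℝ²).prod (volume : Measure ℝ²)).IsAddHaarMeasure

theorem integral_comp_continuousLinearEquiv {V F : Type*} [NormedAddCommGroup V]
    [NormedSpace ℝ V] [FiniteDimensional ℝ V] [MeasurableSpace V] [BorelSpace V]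
    (m : Measure V) [m.IsAddHaarMeasure] [NormedAddCommGroup F] [NormedSpace ℝ F]
    (A : V ≃L[ℝ] V) (f : V → F) :
    ∫ x, f (A x) ∂m = |LinearMap.det (A : V →ₗ[ℝ] V)|⁻¹ • ∫ x, f x ∂m := by
  have hdet : LinearMap.det (A : V →ₗ[ℝ] V) ≠ 0 := (LinearEquiv.isUnit_det' A.toLinearEquiv).ne_zero
  have hmap := Measure.map_linearMap_addHaar_eq_smul_addHaar m hdet
  have hemb : MeasurableEmbedding A := A.toHomeomorph.measurableEmbedding
  have h1 := hemb.integral_map (μ := m) f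
  rw [← h1]
  have h2 : Measure.map (⇑A) m = Measure.map (⇑(A : V →ₗ[ℝ] V)) m := rfl
  rw [h2, hmap, integral_smul_measure, ENNReal.toReal_ofReal (abs_nonneg _), abs_inv]

theorem integral_norm_FT4_comp (A A' : (ℝ² × ℝ²) ≃L[ℝ] (ℝ² × ℝ²))
    (hadj : ∀ z ζ, ⟪(A' z).1, ζ.1⟫ + ⟪(A' z).2, ζ.2⟫ = ⟪z.1, (A ζ).1⟫ + ⟪z.2, (A ζ).2⟫)
    (hdet : |LinearMap.det (A : (ℝ² × ℝ²) →ₗ[ℝ] (ℝ² × ℝ²))| =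
      |LinearMap.det (A' : (ℝ² × ℝ²) →ₗ[ℝ] (ℝ² × ℝ²))|) (F : ℝ² × ℝ² → ℂ) :
    ∫ z, ‖FT4 (fun ζ => F (A ζ)) z‖ = ∫ z, ‖FT4 F z‖ := by
  have hFT : ∀ z, FT4 (fun ζ => F (A ζ)) z =
      |LinearMap.det (A : (ℝ² × ℝ²) →ₗ[ℝ] (ℝ² × ℝ²))|⁻¹ • FT4 F (A'.symm z) := by
    intro z
    have := integral_comp_continuousLinearEquiv volume A (fun η : ℝ² × ℝ² =>
      Complex.exp (-(Complex.I * ((⟪(A'.symm z).1, η.1⟫ + ⟪(A'.symm z).2, η.2⟫ : ℝ) : ℂ))) * F η)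
    unfold FT4
    rw [← this]
    refine integral_congr_ae (.of_forall fun ζ => ?_)
    have h := hadj (A'.symm z) ζ
    simp only [ContinuousLinearEquiv.apply_symm_apply] at h
    simp only [h]
  have h2 := integral_comp_continuousLinearEquiv volume A' (fun z => ‖FT4 F (A'.symm z)‖)
  simp only [ContinuousLinearEquiv.symm_apply_apply] at h2
  simp only [hFT, norm_smul, norm_inv, Real.norm_eq_abs, abs_abs]
  rw [h2, integral_const_mul, hdet, smul_eq_mul]

theorem abs_det_eq_one_of_involutive {V : Type*} [NormedAddCommGroup V]
    [NormedSpace ℝ V] [FiniteDimensional ℝ V] (A : V →ₗ[ℝ] V) (hA : ∀ x, A (A x) = x) :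
    |LinearMap.det A| = 1 := by
  have h : A ∘ₗ A = LinearMap.id := LinearMap.ext hA
  have h2 := congrArg LinearMap.det h
  rw [LinearMap.det_comp, LinearMap.det_id] at h2
  rw [← abs_mul_abs_self] at h2
  nlinarith [abs_nonneg (LinearMap.det A)]

theorem integral_norm_FT4_comp_of_involutive (A A' : (ℝ² × ℝ²) →ₗ[ℝ] (ℝ² × ℝ²))
    (hadj : ∀ z ζ, ⟪(A' z).1, ζ.1⟫ + ⟪(A' z).2, ζ.2⟫ = ⟪z.1, (A ζ).1⟫ + ⟪z.2, (A ζ).2⟫)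
    (hA : ∀ x, A (A x) = x) (hA' : ∀ x, A' (A' x) = x) (F : ℝ² × ℝ² → ℂ) :
    ∫ z, ‖FT4 (fun ζ => F (A ζ)) z‖ = ∫ z, ‖FT4 F z‖ :=
  integral_norm_FT4_comp (LinearEquiv.ofInvolutive A hA).toContinuousLinearEquiv
    (LinearEquiv.ofInvolutive A' hA').toContinuousLinearEquiv hadj
    ((abs_det_eq_one_of_involutive A hA).trans (abs_det_eq_one_of_involutive A' hA').symm) F

theorem integral_norm_FT4_comp_swap (F : ℝ² × ℝ² → ℂ) :
    ∫ z, ‖FT4 (fun ζ => F (ζ.2, ζ.1)) z‖ = ∫ z, ‖FT4 F z‖ :=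
  integral_norm_FT4_comp_of_involutive
    ((LinearMap.snd ℝ ℝ² ℝ²).prod (LinearMap.fst ℝ ℝ² ℝ²))
    ((LinearMap.snd ℝ ℝ² ℝ²).prod (LinearMap.fst ℝ ℝ² ℝ²))
    (fun z ζ => by simp [add_comm]) (fun _ => rfl) (fun _ => rfl) F

theorem integral_norm_FT4_comp_add_neg (F : ℝ² × ℝ² → ℂ) :
    ∫ z, ‖FT4 (fun ζ => F (ζ.1 + ζ.2, -ζ.2)) z‖ = ∫ z, ‖FT4 F z‖ :=
  integral_norm_FT4_comp_of_involutive
    ((LinearMap.fst ℝ ℝ² ℝ² + LinearMap.snd ℝ ℝ² ℝ²).prod (-LinearMap.snd ℝ ℝ² ℝ²))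
    ((LinearMap.fst ℝ ℝ² ℝ²).prod (LinearMap.fst ℝ ℝ² ℝ² - LinearMap.snd ℝ ℝ² ℝ²))
    (fun z ζ => by simp [inner_add_right, inner_sub_left]; ring) (fun _ => by simp)
    (fun _ => by simp) F

theorem integral_norm_FT4_comp_smul {a b : ℝ} (ha : a ≠ 0) (hb : b ≠ 0) (F : ℝ² × ℝ² → ℂ) :
    ∫ z, ‖FT4 (fun ζ => F (a • ζ.1, b • ζ.2)) z‖ = ∫ z, ‖FT4 F z‖ :=
  integral_norm_FT4_comp
    (((LinearEquiv.smulOfNeZero ℝ ℝ² a ha).prodCongr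
      (LinearEquiv.smulOfNeZero ℝ ℝ² b hb)).toContinuousLinearEquiv)
    (((LinearEquiv.smulOfNeZero ℝ ℝ² a ha).prodCongr
      (LinearEquiv.smulOfNeZero ℝ ℝ² b hb)).toContinuousLinearEquiv)
    (fun z ζ => by simp [inner_smul_left, inner_smul_right]) rfl F

theorem integral_norm_FT4_const_mul (c : ℂ) (F : ℝ² × ℝ² → ℂ) :
    ∫ z, ‖FT4 (fun ζ => c * F ζ) z‖ = ‖c‖ * ∫ z, ‖FT4 F z‖ := by
  have : ∀ z, FT4 (fun ζ => c * F ζ) z = c * FT4 F z := fun z => by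
    unfold FT4
    rw [← integral_const_mul]
    exact integral_congr_ae (.of_forall fun ζ => by ring)
  simp only [this, norm_mul, integral_const_mul]

/-- The bilinear form `(⟪z₁, ζ₁⟫ + ⟪z₂, ζ₂⟫) / 2π`. -/
def pairing : (ℝ² × ℝ²) →L[ℝ] (ℝ² × ℝ²) →L[ℝ] ℝ :=
  (2 * Real.pi)⁻¹ •
    ((innerSL ℝ).bilinearComp (ContinuousLinearMap.fst ℝ ℝ² ℝ²) (ContinuousLinearMap.fst ℝ ℝ² ℝ²) +
     (innerSL ℝ).bilinearComp (ContinuousLinearMap.snd ℝ ℝ² ℝ²) (ContinuousLinearMap.snd ℝ ℝ² ℝ²))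

theorem pairing_apply (v w : ℝ² × ℝ²) :
    pairing v w = (2 * Real.pi)⁻¹ * (⟪v.1, w.1⟫ + ⟪v.2, w.2⟫) := by
  simp [pairing, mul_add]

theorem FT4_eq_fourierIntegral (F : ℝ² × ℝ² → ℂ) :
    FT4 F = VectorFourier.fourierIntegral Real.fourierChar volume pairing.toLinearMap₁₂ F := by
  ext z
  unfold FT4 VectorFourier.fourierIntegral
  refine integral_congr_ae (.of_forall fun ζ => ?_)
  have h : pairing.toLinearMap₁₂ ζ z = (2 * Real.pi)⁻¹ * (⟪z.1, ζ.1⟫ + ⟪z.2, ζ.2⟫) := by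
    rw [real_inner_comm, real_inner_comm ζ.2]
    exact pairing_apply ζ z
  simp only [h, Circle.smul_def, Real.fourierChar_apply, smul_eq_mul]
  congr 2
  have := Real.pi_ne_zero
  push_cast
  field_simp

theorem norm_pow_mul_FT4_le {F : ℝ² × ℝ² → ℂ} (hF : ContDiff ℝ (⊤ : ℕ∞) F)
    (hc : HasCompactSupport F) (n : ℕ) (w : ℝ² × ℝ²) :
    ‖w‖ ^ n * ‖FT4 F w‖ ≤
      (4 * Real.pi) ^ n * ∑ i ∈ Finset.range (n + 1), ∫ v, ‖iteratedFDeriv ℝ i F v‖ := by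
  have key := VectorFourier.pow_mul_norm_iteratedFDeriv_fourierIntegral_le (μ := volume)
    pairing (K := ⊤) (N := ⊤) hF (fun k n _ _ => by
      refine Continuous.integrable_of_hasCompactSupport ?_ ?_
      · exact (continuous_norm.pow k).mul (hF.continuous_iteratedFDeriv (mod_cast le_top)).norm
      · exact (hc.iteratedFDeriv n).norm.mul_left) (k := 0) (n := n) le_top le_top w w
  rw [← FT4_eq_fourierIntegral] at key
  simp only [norm_iteratedFDeriv_zero, zero_add, Finset.range_one, pow_zero, mul_one, Nat.cast_zero,
    mul_zero, Finset.singleton_product, Finset.sum_map, Function.Embedding.coeFn_mk, one_mul] at key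
  set S := ∑ i ∈ Finset.range (n + 1), ∫ v, ‖iteratedFDeriv ℝ i F v‖
  have hS0 : 0 ≤ S := Finset.sum_nonneg fun i _ => integral_nonneg fun v => norm_nonneg _
  have hπ := Real.pi_pos
  rcases (pow_nonneg (norm_nonneg w) n).eq_or_lt with h0 | h0
  · rw [← h0, zero_mul]; positivity
  have hw : ‖w‖ ^ 2 ≤ 2 * Real.pi * |pairing w w| := by
    rw [pairing_apply, real_inner_self_eq_norm_sq, real_inner_self_eq_norm_sq,
      abs_of_nonneg (by positivity), mul_inv_cancel_left₀ (by positivity), Prod.norm_def]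
    rcases max_choice ‖w.1‖ ‖w.2‖ with h | h <;> rw [h] <;> nlinarith [sq_nonneg ‖w.1‖, sq_nonneg ‖w.2‖]
  refine le_of_mul_le_mul_left ?_ h0
  calc ‖w‖ ^ n * (‖w‖ ^ n * ‖FT4 F w‖) = (‖w‖ ^ 2) ^ n * ‖FT4 F w‖ := by ring
    _ ≤ (2 * Real.pi * |pairing w w|) ^ n * ‖FT4 F w‖ := by gcongr
    _ = (2 * Real.pi) ^ n * (|pairing w w| ^ n * ‖FT4 F w‖) := by ring
    _ ≤ (2 * Real.pi) ^ n * (‖w‖ ^ n * 2 ^ n * S) := by gcongr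
    _ = ‖w‖ ^ n * ((4 * Real.pi) ^ n * S) := by
      rw [show (4 : ℝ) * Real.pi = 2 * Real.pi * 2 by ring, mul_pow _ (2 : ℝ)]; ring

/-- If `F` and its derivatives of order at most `5` are uniformly bounded, then so is the `L¹` norm
of the Fourier transform. -/
theorem exists_integral_norm_FT4_le {K : Set (ℝ² × ℝ²)} (hK : IsCompact K) (B : ℝ) :
    ∃ C : ℝ, ∀ F : ℝ² × ℝ² → ℂ, ContDiff ℝ (⊤ : ℕ∞) F → Function.support F ⊆ K →
      (∀ i ≤ 5, ∀ v ∈ K, ‖iteratedFDeriv ℝ i F v‖ ≤ B) → ∫ z, ‖FT4 F z‖ ≤ C := by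
  set c : ℝ := 2 ^ 5 * (6 * (B * volume.real K) + (4 * Real.pi) ^ 5 * (6 * (B * volume.real K)))
  refine ⟨∫ z : ℝ² × ℝ², c * (1 + ‖z‖) ^ (-5 : ℝ), fun F hF hsupp hB => ?_⟩
  have hts : tsupport F ⊆ K := closure_minimal hsupp hK.isClosed
  have hc : HasCompactSupport F := hK.of_isClosed_subset isClosed_closure hts
  have hI : ∀ i ≤ 5, ∫ v, ‖iteratedFDeriv ℝ i F v‖ ≤ B * volume.real K := fun i hi => by
    have hz : ∀ v, v ∉ K → ‖iteratedFDeriv ℝ i F v‖ = 0 := fun v hv => by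
      rw [norm_eq_zero]
      by_contra h
      exact hv (hts (support_iteratedFDeriv_subset i h))
    rw [← setIntegral_eq_integral_of_forall_compl_eq_zero hz]
    refine (Real.le_norm_self _).trans (norm_setIntegral_le_of_norm_le_const hK.measure_lt_top ?_)
    intro v hv
    rw [norm_norm]
    exact hB i hi v hv
  have hB0 : 0 ≤ B * volume.real K := (integral_nonneg fun v => norm_nonneg _).trans (hI 0 (by simp))
  have hS : ∀ n ≤ 5, ∑ i ∈ Finset.range (n + 1), ∫ v, ‖iteratedFDeriv ℝ i F v‖ ≤
      6 * (B * volume.real K) := fun n hn => by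
    refine (Finset.sum_le_card_nsmul _ _ (B * volume.real K) fun i hi => hI i ?_).trans ?_
    · have := Finset.mem_range.1 hi; omega
    · rw [nsmul_eq_mul, Finset.card_range]
      gcongr
      exact_mod_cast (by omega : n + 1 ≤ 6)
  refine integral_mono_of_nonneg (.of_forall fun z => norm_nonneg _) ?_ (.of_forall fun z => ?_)
  · refine (integrable_one_add_norm ?_).const_mul c
    simp; norm_num
  have h0 := (norm_pow_mul_FT4_le hF hc 0 z).trans
    (mul_le_mul_of_nonneg_left (hS 0 (by simp)) (by positivity))
  have h5 := (norm_pow_mul_FT4_le hF hc 5 z).trans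
    (mul_le_mul_of_nonneg_left (hS 5 le_rfl) (by positivity))
  simp only [pow_zero, one_mul] at h0
  have hz := norm_nonneg z
  have hp : (1 + ‖z‖) ^ 5 ≤ 2 ^ 5 * (1 + ‖z‖ ^ 5) := by
    refine (add_pow_le zero_le_one hz 5).trans ?_
    norm_num
    have : 0 ≤ ‖z‖ ^ 5 := by positivity
    nlinarith
  change ‖FT4 F z‖ ≤ c * (1 + ‖z‖) ^ (-5 : ℝ)
  rw [Real.rpow_neg (by positivity), ← div_eq_mul_inv, le_div_iff₀ (by positivity),
    show (1 + ‖z‖) ^ (5 : ℝ) = (1 + ‖z‖) ^ (5 : ℕ) by norm_cast]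
  calc ‖FT4 F z‖ * (1 + ‖z‖) ^ 5 ≤ ‖FT4 F z‖ * (2 ^ 5 * (1 + ‖z‖ ^ 5)) := by gcongr
    _ = 2 ^ 5 * (‖FT4 F z‖ + ‖z‖ ^ 5 * ‖FT4 F z‖) := by ring
    _ ≤ c := mul_le_mul_of_nonneg_left (add_le_add h0 h5) (by norm_num)

theorem exists_integral_norm_FT4_family_le {P : Type*} [NormedAddCommGroup P] [NormedSpace ℝ P]
    {S : Set P} (hS : IsCompact S) {K : Set (ℝ² × ℝ²)} (hK : IsCompact K)
    {H : P × (ℝ² × ℝ²) → ℂ} (hH : ContDiff ℝ (⊤ : ℕ∞) H)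
    (hsupp : ∀ s v, H (s, v) ≠ 0 → v ∈ K) :
    ∃ C : ℝ, ∀ s ∈ S, ∫ z, ‖FT4 (fun ζ => H (s, ζ)) z‖ ≤ C := by
  have hbd : ∃ B : ℝ, ∀ i ≤ 5, ∀ q ∈ S ×ˢ K, ‖iteratedFDeriv ℝ i H q‖ ≤ B := by
    choose B hB using fun i : ℕ => (hS.prod hK).exists_bound_of_continuousOn
      (hH.continuous_iteratedFDeriv (m := i) (mod_cast le_top)).continuousOn
    exact ⟨∑ i ∈ Finset.range 6, |B i|, fun i hi q hq => (hB i q hq).trans ((le_abs_self _).trans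
      (Finset.single_le_sum (f := fun i => |B i|) (fun j _ => abs_nonneg _)
        (Finset.mem_range.2 (by omega))))⟩
  obtain ⟨B, hB⟩ := hbd
  obtain ⟨C, hC⟩ := exists_integral_norm_FT4_le hK B
  refine ⟨C, fun s hs => hC _ (hH.comp (contDiff_const.prodMk contDiff_id))
    (fun v hv => hsupp s v hv) fun i hi v hv => ?_⟩
  have hcomp : (fun ζ => H (s, ζ)) =
      (fun q => H ((s, 0) + q)) ∘ ContinuousLinearMap.inr ℝ P (ℝ² × ℝ²) := by
    ext ζ; simp
  rw [hcomp, ContinuousLinearMap.iteratedFDeriv_comp_right _ (n := (⊤ : ℕ∞))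
    (f := fun q => H ((s, 0) + q)) (hH.comp (contDiff_const.add contDiff_id)) v (mod_cast le_top),
    iteratedFDeriv_comp_add_left]
  refine (ContinuousMultilinearMap.norm_compContinuousLinearMap_le _ _).trans ?_
  have h1 : ‖iteratedFDeriv ℝ i H ((s, 0) + ContinuousLinearMap.inr ℝ P (ℝ² × ℝ²) v)‖ ≤ B :=
    hB i hi _ (by simpa using ⟨hs, hv⟩)
  refine (mul_le_of_le_one_right (norm_nonneg _) ?_).trans h1
  exact Finset.prod_le_one (fun _ _ => norm_nonneg _)
    fun _ _ => ContinuousLinearMap.norm_inr_le_one ℝ P (ℝ² × ℝ²)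

/-- Smooth cutoffs supported in the annulus `3/8 ≤ ‖x‖ ≤ 3/2`. -/
def IsAnnular (χ : ℝ² → ℝ) : Prop :=
  ContDiff ℝ (⊤ : ℕ∞) χ ∧ ∀ x, χ x ≠ 0 → 3 / 8 ≤ ‖x‖ ∧ ‖x‖ ≤ 3 / 2

theorem IsAnnular.comp_neg {χ : ℝ² → ℝ} (h : IsAnnular χ) : IsAnnular fun x => χ (-x) :=
  ⟨h.1.comp contDiff_neg, fun x hx => by simpa using h.2 _ hx⟩

theorem IsAnnular.eventually_eq_zero {χ : ℝ² → ℝ} (h : IsAnnular χ) :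
    ∀ᶠ x in nhds (0 : ℝ²), χ x = 0 := by
  filter_upwards [Metric.ball_mem_nhds (0 : ℝ²) (show (0 : ℝ) < 3 / 8 by norm_num)] with x hx
  by_contra hne
  have := (h.2 x hne).1
  rw [mem_ball_zero_iff] at hx
  linarith

/-- A profile `Ψ(ε, x, y)` which is smooth and does not vanish where `x`, `y` and `ε² x + y`
are nonzero. -/
def IsRegularProfile (Ψ : ℝ × (ℝ² × ℝ²) → ℝ) : Prop :=
  ∀ ε x y, x ≠ 0 → y ≠ 0 → ε ^ 2 • x + y ≠ 0 →
    ContDiffAt ℝ (⊤ : ℕ∞) Ψ (ε, x, y) ∧ Ψ (ε, x, y) ≠ 0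

theorem IsRegularProfile.exists_integral_norm_FT4_le {χ₁ χ₂ χ₃ : ℝ² → ℝ} (h₁ : IsAnnular χ₁)
    (h₂ : IsAnnular χ₂) (h₃ : IsAnnular χ₃) {Ψ : ℝ × (ℝ² × ℝ²) → ℝ} (hΨ : IsRegularProfile Ψ)
    (R : ℝ) :
    ∃ C : ℝ, ∀ ε ∈ Set.Icc (0 : ℝ) 1, ∀ δ ∈ Set.Icc (0 : ℝ) R,
      ∫ z, ‖FT4 (fun ζ => ((χ₃ (δ • (ε ^ 2 • ζ.1 + ζ.2)) * (Ψ (ε, ζ))⁻¹ *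
        (χ₁ ζ.1 * χ₂ ζ.2) : ℝ) : ℂ)) z‖ ≤ C := by
  let H : (ℝ × ℝ) × (ℝ² × ℝ²) → ℝ := fun q =>
    χ₃ (q.1.2 • (q.1.1 ^ 2 • q.2.1 + q.2.2)) * (Ψ (q.1.1, q.2))⁻¹ * (χ₁ q.2.1 * χ₂ q.2.2)
  have hH : ContDiff ℝ (⊤ : ℕ∞) H := by
    rw [contDiff_iff_contDiffAt]
    rintro ⟨⟨ε, δ⟩, x, y⟩
    have hzero : (∀ᶠ q in nhds (((ε, δ), x, y) : (ℝ × ℝ) × (ℝ² × ℝ²)), H q = 0) →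
        ContDiffAt ℝ (⊤ : ℕ∞) H ((ε, δ), x, y) := fun h =>
      (contDiffAt_const (c := (0 : ℝ))).congr_of_eventuallyEq h
    by_cases hx : x = 0
    · refine hzero ?_
      have ht : Filter.Tendsto (fun q : (ℝ × ℝ) × (ℝ² × ℝ²) => q.2.1)
          (nhds ((ε, δ), x, y)) (nhds 0) :=
        Continuous.tendsto' (by fun_prop) _ _ hx
      filter_upwards [ht.eventually h₁.eventually_eq_zero] with q hq
      simp [H, hq]
    by_cases hy : y = 0
    · refine hzero ?_
      have ht : Filter.Tendsto (fun q : (ℝ × ℝ) × (ℝ² × ℝ²) => q.2.2)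
          (nhds ((ε, δ), x, y)) (nhds 0) :=
        Continuous.tendsto' (by fun_prop) _ _ hy
      filter_upwards [ht.eventually h₂.eventually_eq_zero] with q hq
      simp [H, hq]
    by_cases hxy : ε ^ 2 • x + y = 0
    · refine hzero ?_
      have ht : Filter.Tendsto
          (fun q : (ℝ × ℝ) × (ℝ² × ℝ²) => q.1.2 • (q.1.1 ^ 2 • q.2.1 + q.2.2))
          (nhds ((ε, δ), x, y)) (nhds 0) :=
        Continuous.tendsto' (by fun_prop) _ _ (by simp [hxy])
      filter_upwards [ht.eventually h₃.eventually_eq_zero] with q hq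
      simp only [H, hq, zero_mul]
    obtain ⟨hs, hne⟩ := hΨ ε x y hx hy hxy
    have hs' : ContDiffAt ℝ (⊤ : ℕ∞) (fun q : (ℝ × ℝ) × (ℝ² × ℝ²) => Ψ (q.1.1, q.2))
        ((ε, δ), x, y) :=
      ContDiffAt.comp (g := Ψ) (f := fun q : (ℝ × ℝ) × (ℝ² × ℝ²) => (q.1.1, q.2)) _ hs
        (by fun_prop)
    refine ContDiffAt.mul (ContDiffAt.mul ?_ (hs'.inv hne)) (ContDiffAt.mul ?_ ?_)
    · exact (h₃.1.comp (f := fun q : (ℝ × ℝ) × (ℝ² × ℝ²) =>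
        q.1.2 • (q.1.1 ^ 2 • q.2.1 + q.2.2)) (by fun_prop)).contDiffAt
    · exact (h₁.1.comp (f := fun q : (ℝ × ℝ) × (ℝ² × ℝ²) => q.2.1) (by fun_prop)).contDiffAt
    · exact (h₂.1.comp (f := fun q : (ℝ × ℝ) × (ℝ² × ℝ²) => q.2.2) (by fun_prop)).contDiffAt
  obtain ⟨C, hC⟩ := exists_integral_norm_FT4_family_le
    (S := Set.Icc (0 : ℝ) 1 ×ˢ Set.Icc (0 : ℝ) R)
    (K := Metric.closedBall 0 (3 / 2) ×ˢ Metric.closedBall 0 (3 / 2))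
    (H := fun q => ((H q : ℝ) : ℂ)) (isCompact_Icc.prod isCompact_Icc)
    ((isCompact_closedBall _ _).prod (isCompact_closedBall _ _))
    (Complex.ofRealCLM.contDiff.comp hH) (fun s v hv => by
      have hv' : H (s, v) ≠ 0 := by simpa using hv
      have ha := right_ne_zero_of_mul hv'
      exact ⟨by simpa using (h₁.2 _ (left_ne_zero_of_mul ha)).2,
        by simpa using (h₂.2 _ (right_ne_zero_of_mul ha)).2⟩)
  exact ⟨C, fun ε hε δ hδ => hC (ε, δ) ⟨hε, hδ⟩⟩

theorem sqrt_lt_add_sqrt_of_le {a b c : ℝ} (hb : 0 < b) (hc : 0 < c) (h : a ≤ b + c) :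
    √a < √b + √c := by
  rw [Real.sqrt_lt' (by positivity)]
  nlinarith [Real.sq_sqrt hb.le, Real.sq_sqrt hc.le,
    mul_pos (Real.sqrt_pos.2 hb) (Real.sqrt_pos.2 hc)]

theorem sqrt_norm_sq_smul (ε : ℝ) (x : ℝ²) : √‖ε ^ 2 • x‖ = |ε| * √‖x‖ := by
  rw [norm_smul, Real.norm_of_nonneg (sq_nonneg ε), Real.sqrt_mul (sq_nonneg ε), Real.sqrt_sq_eq_abs]

/-- `±√‖ε² x + y‖ ± √‖y‖ ± ε √‖x‖`, with equal first two signs. -/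
theorem isRegularProfile_of_eq_sign {α β : ℝ} (hα : α = 1 ∨ α = -1) (hβ : β = 1 ∨ β = -1) :
    IsRegularProfile fun q =>
      α * (√‖q.1 ^ 2 • q.2.1 + q.2.2‖ + √‖q.2.2‖) + β * (q.1 * √‖q.2.1‖) := by
  intro ε x y hx hy hxy
  constructor
  · have nx := norm_ne_zero_iff.2 hx
    have ny := norm_ne_zero_iff.2 hy
    have nxy := norm_ne_zero_iff.2 hxy
    have n1 : ContDiffAt ℝ (⊤ : ℕ∞)
        (fun q : ℝ × (ℝ² × ℝ²) => ‖q.1 ^ 2 • q.2.1 + q.2.2‖) (ε, x, y) :=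
      ContDiffAt.norm ℝ (by fun_prop) hxy
    have n2 : ContDiffAt ℝ (⊤ : ℕ∞) (fun q : ℝ × (ℝ² × ℝ²) => ‖q.2.2‖) (ε, x, y) :=
      ContDiffAt.norm ℝ (by fun_prop) hy
    have n3 : ContDiffAt ℝ (⊤ : ℕ∞) (fun q : ℝ × (ℝ² × ℝ²) => ‖q.2.1‖) (ε, x, y) :=
      ContDiffAt.norm ℝ (by fun_prop) hx
    exact (contDiffAt_const.mul ((n1.sqrt nxy).add (n2.sqrt ny))).add
      (contDiffAt_const.mul (.mul (by fun_prop) (n3.sqrt nx)))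
  · have h : |ε| * √‖x‖ < √‖ε ^ 2 • x + y‖ + √‖y‖ := by
      rw [← sqrt_norm_sq_smul]
      refine sqrt_lt_add_sqrt_of_le (norm_pos_iff.2 hxy) (norm_pos_iff.2 hy) ?_
      simpa using norm_sub_le (ε ^ 2 • x + y) y
    have h' : |ε * √‖x‖| < √‖ε ^ 2 • x + y‖ + √‖y‖ := by
      rwa [abs_mul, abs_of_nonneg (Real.sqrt_nonneg _)]
    obtain ⟨h1, h2⟩ := abs_lt.1 h'
    dsimp only
    rcases hα with rfl | rfl <;> rcases hβ with rfl | rfl <;> intro h0 <;> linarith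

/-- The difference `√‖ε² x + y‖ - √‖y‖` with the factor `ε²` extracted. -/
theorem sqrt_norm_sub_sqrt_norm {ε : ℝ} {x y : ℝ²} (hy : y ≠ 0) :
    √‖ε ^ 2 • x + y‖ - √‖y‖ = ε * (ε * ((2 * ⟪x, y⟫ + ε ^ 2 * ⟪x, x⟫) /
      ((√‖ε ^ 2 • x + y‖ + √‖y‖) * (‖ε ^ 2 • x + y‖ + ‖y‖)))) := by
  have h1 : 0 < √‖ε ^ 2 • x + y‖ + √‖y‖ :=
    add_pos_of_nonneg_of_pos (Real.sqrt_nonneg _) (Real.sqrt_pos.2 (norm_pos_iff.2 hy))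
  have h2 : 0 < ‖ε ^ 2 • x + y‖ + ‖y‖ := add_pos_of_nonneg_of_pos (norm_nonneg _) (norm_pos_iff.2 hy)
  have h3 : ‖ε ^ 2 • x + y‖ ^ 2 = ε ^ 2 * (2 * ⟪x, y⟫ + ε ^ 2 * ⟪x, x⟫) + ‖y‖ ^ 2 := by
    rw [norm_add_sq_real, norm_smul, real_inner_smul_left, mul_pow, Real.norm_eq_abs, sq_abs,
      real_inner_self_eq_norm_sq]
    ring
  have h4 := Real.sq_sqrt (norm_nonneg (ε ^ 2 • x + y))
  have h5 := Real.sq_sqrt (norm_nonneg y)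
  field_simp
  calc (√‖ε ^ 2 • x + y‖ - √‖y‖) * (√‖ε ^ 2 • x + y‖ + √‖y‖) * (‖ε ^ 2 • x + y‖ + ‖y‖)
      = (√‖ε ^ 2 • x + y‖ ^ 2 - √‖y‖ ^ 2) * (‖ε ^ 2 • x + y‖ + ‖y‖) := by ring
    _ = _ := by rw [h4, h5]; linear_combination h3

/-- `(±√‖ε² x + y‖ ∓ √‖y‖) / ε ± √‖x‖`, extended smoothly to `ε = 0`. -/
theorem isRegularProfile_of_opposite_sign {α β : ℝ} (hα : α = 1 ∨ α = -1) (hβ : β = 1 ∨ β = -1) :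
    IsRegularProfile fun q =>
      α * (q.1 * ((2 * ⟪q.2.1, q.2.2⟫ + q.1 ^ 2 * ⟪q.2.1, q.2.1⟫) /
        ((√‖q.1 ^ 2 • q.2.1 + q.2.2‖ + √‖q.2.2‖) * (‖q.1 ^ 2 • q.2.1 + q.2.2‖ + ‖q.2.2‖)))) +
      β * √‖q.2.1‖ := by
  intro ε x y hx hy hxy
  have nx := norm_pos_iff.2 hx
  have ny := norm_pos_iff.2 hy
  have nxy := norm_pos_iff.2 hxy
  constructor
  · have n1 : ContDiffAt ℝ (⊤ : ℕ∞)
        (fun q : ℝ × (ℝ² × ℝ²) => ‖q.1 ^ 2 • q.2.1 + q.2.2‖) (ε, x, y) :=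
      ContDiffAt.norm ℝ (by fun_prop) hxy
    have n2 : ContDiffAt ℝ (⊤ : ℕ∞) (fun q : ℝ × (ℝ² × ℝ²) => ‖q.2.2‖) (ε, x, y) :=
      ContDiffAt.norm ℝ (by fun_prop) hy
    have n3 : ContDiffAt ℝ (⊤ : ℕ∞) (fun q : ℝ × (ℝ² × ℝ²) => ‖q.2.1‖) (ε, x, y) :=
      ContDiffAt.norm ℝ (by fun_prop) hx
    refine (contDiffAt_const.mul (.mul (by fun_prop) (.div ?_ ?_ ?_))).add
      (contDiffAt_const.mul (n3.sqrt nx.ne'))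
    · exact (contDiffAt_const.mul (.inner ℝ (by fun_prop) (by fun_prop))).add
        (.mul (by fun_prop) (.inner ℝ (by fun_prop) (by fun_prop)))
    · exact ((n1.sqrt nxy.ne').add (n2.sqrt ny.ne')).mul (n1.add n2)
    · dsimp only
      positivity
  · dsimp only
    intro h0
    have hsx : 0 < √‖x‖ := Real.sqrt_pos.2 nx
    rcases eq_or_ne ε 0 with rfl | hε
    · rcases hβ with rfl | rfl <;> simp at h0 <;> exact hx h0
    have h1 := sqrt_norm_sub_sqrt_norm (ε := ε) (x := x) hy
    have hεx : ε ^ 2 • x ≠ 0 := smul_ne_zero (pow_ne_zero 2 hε) hx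
    have h2 := sqrt_lt_add_sqrt_of_le (norm_pos_iff.2 hεx) ny (norm_add_le (ε ^ 2 • x) y)
    have h3 : √‖y‖ < √‖ε ^ 2 • x‖ + √‖ε ^ 2 • x + y‖ :=
      sqrt_lt_add_sqrt_of_le (norm_pos_iff.2 hεx) nxy (by
        have := norm_sub_le (ε ^ 2 • x + y) (ε ^ 2 • x)
        rw [add_sub_cancel_left] at this
        linarith)
    rw [sqrt_norm_sq_smul] at h2 h3
    have h4 : α * (√‖ε ^ 2 • x + y‖ - √‖y‖) + β * (ε * √‖x‖) = 0 := by
      rw [h1]; linear_combination ε * h0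
    rcases hα with rfl | rfl <;> rcases hβ with rfl | rfl <;>
      rcases abs_cases ε with ⟨ha, -⟩ | ⟨ha, -⟩ <;> rw [ha] at h2 h3 <;> linarith

/-- The phase `α ‖ξ₁ + ξ₂‖^{1/2} + β ‖ξ₁‖^{1/2} + γ ‖ξ₂‖^{1/2}`. -/
def signedPhase (α β γ : ℝ) (p : ℝ² × ℝ²) : ℝ :=
  α * √‖p.1 + p.2‖ + β * √‖p.1‖ + γ * √‖p.2‖

/-- The reciprocal of `signedPhase` localized to dyadic annuli. -/
def signedSymbol (χ₁ χ₂ χ₃ : ℝ² → ℝ) (α β γ : ℝ) (k₁ k₂ k₃ : ℤ) (p : ℝ² × ℝ²) : ℝ :=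
  χ₃ ((2 : ℝ) ^ (-k₃) • (p.1 + p.2)) * (signedPhase α β γ p)⁻¹ *
    (χ₁ ((2 : ℝ) ^ (-k₁) • p.1) * χ₂ ((2 : ℝ) ^ (-k₂) • p.2))

theorem IsAnnular.norm_bounds {χ : ℝ² → ℝ} (h : IsAnnular χ) {k : ℤ} {x : ℝ²}
    (hx : χ ((2 : ℝ) ^ (-k) • x) ≠ 0) :
    3 / 8 * (2 : ℝ) ^ k ≤ ‖x‖ ∧ ‖x‖ ≤ 3 / 2 * (2 : ℝ) ^ k := by
  have h2 : (0 : ℝ) < 2 ^ k := by positivity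
  obtain ⟨hl, hu⟩ := h.2 _ hx
  rw [norm_smul, zpow_neg, norm_inv, Real.norm_of_nonneg h2.le, inv_mul_eq_div] at hl hu
  exact ⟨(le_div_iff₀ h2).1 hl, (div_le_iff₀ h2).1 hu⟩

theorem signedSymbol_ne_zero {χ₁ χ₂ χ₃ : ℝ² → ℝ} (h₁ : IsAnnular χ₁)
    (h₂ : IsAnnular χ₂) (h₃ : IsAnnular χ₃) {α β γ : ℝ} {k₁ k₂ k₃ : ℤ} {p : ℝ² × ℝ²}
    (hp : signedSymbol χ₁ χ₂ χ₃ α β γ k₁ k₂ k₃ p ≠ 0) :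
    3 / 8 * (2 : ℝ) ^ k₂ ≤ 3 / 2 * (2 : ℝ) ^ k₁ + 3 / 2 * (2 : ℝ) ^ k₃ := by
  have ha := right_ne_zero_of_mul hp
  have b₁ := h₁.norm_bounds (left_ne_zero_of_mul ha)
  have b₂ := h₂.norm_bounds (right_ne_zero_of_mul ha)
  have b₃ := h₃.norm_bounds (left_ne_zero_of_mul (left_ne_zero_of_mul hp))
  have := norm_sub_le (p.1 + p.2) p.1
  rw [add_sub_cancel_left] at this
  linarith [b₁.2, b₂.1, b₃.2]

theorem rpow_half_sq (k : ℤ) : ((2 : ℝ) ^ ((k : ℝ) / 2)) ^ 2 = (2 : ℝ) ^ k := by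
  rw [← Real.rpow_natCast, ← Real.rpow_mul zero_le_two, ← Real.rpow_intCast]
  congr 1
  push_cast
  ring

theorem signedSymbol_smul (χ₁ χ₂ χ₃ : ℝ² → ℝ) (α β γ : ℝ) (k₁ k₂ k₃ : ℤ) (x y : ℝ²) {a b : ℝ}
    (ha : 0 < a) (hb : 0 < b) (hak : a ^ 2 = (2 : ℝ) ^ k₁) (hbk : b ^ 2 = (2 : ℝ) ^ k₂) :
    signedSymbol χ₁ χ₂ χ₃ α β γ k₁ k₂ k₃ (a ^ 2 • x, b ^ 2 • y) =
      χ₃ ((2 : ℝ) ^ (k₂ - k₃) • ((a / b) ^ 2 • x + y)) *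
        (α * (b * √‖(a / b) ^ 2 • x + y‖) + β * (a * √‖x‖) + γ * (b * √‖y‖))⁻¹ *
        (χ₁ x * χ₂ y) := by
  have hs : ∀ {c : ℝ}, 0 < c → ∀ v : ℝ², √‖c ^ 2 • v‖ = c * √‖v‖ := fun {c} hc v => by
    rw [norm_smul, Real.norm_of_nonneg (sq_nonneg c), Real.sqrt_mul (sq_nonneg c),
      Real.sqrt_sq hc.le]
  have hadd : a ^ 2 • x + b ^ 2 • y = b ^ 2 • ((a / b) ^ 2 • x + y) := by
    rw [smul_add, smul_smul, div_pow, mul_div_cancel₀ _ (by positivity)]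
  have hc : ∀ (k : ℤ) (v : ℝ²), (2 : ℝ) ^ (-k) • (2 : ℝ) ^ k • v = v := fun k v => by
    rw [smul_smul, ← zpow_add₀ two_ne_zero, neg_add_cancel, zpow_zero, one_smul]
  simp only [signedSymbol, signedPhase, hadd, hs ha, hs hb]
  rw [hak, hbk, hc, hc, smul_smul ((2 : ℝ) ^ (-k₃)), ← zpow_add₀ two_ne_zero,
    show -k₃ + k₂ = k₂ - k₃ by ring]

theorem integral_norm_FT4_eq_zero {F : ℝ² × ℝ² → ℂ} (hF : ∀ p, F p = 0) :
    ∫ z, ‖FT4 F z‖ = 0 := by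
  simp [FT4, hF]

theorem IsRegularProfile.exists_signedSymbol_le {χ₁ χ₂ χ₃ : ℝ² → ℝ} (h₁ : IsAnnular χ₁)
    (h₂ : IsAnnular χ₂) (h₃ : IsAnnular χ₃) {Ψ : ℝ × (ℝ² × ℝ²) → ℝ} (hΨ : IsRegularProfile Ψ)
    {α β γ : ℝ} {s : ℝ → ℝ → ℝ} (hs : ∀ a b, 0 < a → 0 < b → 0 < s a b)
    (hsΨ : ∀ a b x y, 0 < a → 0 < b → y ≠ 0 →
      α * (b * √‖(a / b) ^ 2 • x + y‖) + β * (a * √‖x‖) + γ * (b * √‖y‖) =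
        s a b * Ψ (a / b, x, y)) :
    ∃ C : ℝ, ∀ k₁ k₂ k₃ : ℤ, k₁ ≤ k₂ → k₁ ≤ k₃ →
      ∫ z, ‖FT4 (fun ζ => (signedSymbol χ₁ χ₂ χ₃ α β γ k₁ k₂ k₃ ζ : ℂ)) z‖ ≤
        C * (s ((2 : ℝ) ^ ((k₁ : ℝ) / 2)) ((2 : ℝ) ^ ((k₂ : ℝ) / 2)))⁻¹ := by
  obtain ⟨C, hC⟩ := hΨ.exists_integral_norm_FT4_le h₁ h₂ h₃ 8
  have hC0 : 0 ≤ C := (integral_nonneg fun _ => norm_nonneg _).trans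
    (hC 0 (by simp) 0 (by simp))
  refine ⟨C, fun k₁ k₂ k₃ h12 h13 => ?_⟩
  set a : ℝ := (2 : ℝ) ^ ((k₁ : ℝ) / 2)
  set b : ℝ := (2 : ℝ) ^ ((k₂ : ℝ) / 2)
  have ha : 0 < a := by positivity
  have hb : 0 < b := by positivity
  have hak : a ^ 2 = (2 : ℝ) ^ k₁ := rpow_half_sq k₁
  have hbk : b ^ 2 = (2 : ℝ) ^ k₂ := rpow_half_sq k₂
  have hsab := hs a b ha hb
  by_cases hzero : ∀ ζ, signedSymbol χ₁ χ₂ χ₃ α β γ k₁ k₂ k₃ ζ = 0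
  · rw [integral_norm_FT4_eq_zero fun p => by simp [hzero p]]
    positivity
  push Not at hzero
  obtain ⟨p, hp⟩ := hzero
  have hδ : (2 : ℝ) ^ (k₂ - k₃) ≤ 8 := by
    have h := signedSymbol_ne_zero h₁ h₂ h₃ hp
    have h' : (2 : ℝ) ^ k₁ ≤ 2 ^ k₃ := zpow_le_zpow_right₀ one_le_two h13
    rw [zpow_sub₀ two_ne_zero, div_le_iff₀ (by positivity)]
    linarith
  have hε : a / b ≤ 1 := by
    rw [div_le_one hb]
    exact Real.rpow_le_rpow_of_exponent_le one_le_two (by gcongr)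
  have hresc : ∀ ζ : ℝ² × ℝ²,
      (signedSymbol χ₁ χ₂ χ₃ α β γ k₁ k₂ k₃ (a ^ 2 • ζ.1, b ^ 2 • ζ.2) : ℂ) =
      ((s a b)⁻¹ : ℝ) * ((χ₃ ((2 : ℝ) ^ (k₂ - k₃) • ((a / b) ^ 2 • ζ.1 + ζ.2)) *
        (Ψ (a / b, ζ))⁻¹ * (χ₁ ζ.1 * χ₂ ζ.2) : ℝ) : ℂ) := by
    rintro ⟨x, y⟩
    rw [signedSymbol_smul _ _ _ _ _ _ _ _ _ _ _ ha hb hak hbk, ← Complex.ofReal_mul]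
    congr 1
    rcases eq_or_ne y 0 with rfl | hy
    · have : χ₂ 0 = 0 := by
        by_contra h
        have := (h₂.2 0 h).1
        norm_num at this
      simp [this]
    · rw [hsΨ a b x y ha hb hy, mul_inv]
      ring
  rw [← integral_norm_FT4_comp_smul (pow_ne_zero 2 ha.ne') (pow_ne_zero 2 hb.ne')]
  simp only [hresc]
  rw [integral_norm_FT4_const_mul, Complex.norm_real, Real.norm_of_nonneg (by positivity), mul_comm]
  gcongr
  exact hC _ ⟨by positivity, hε⟩ _ ⟨by positivity, hδ⟩

/-- The bound `2 ^ (-k₁ / 2)` for the smallest frequency `2 ^ k₁`, improved to `2 ^ (-k₂ / 2)` when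
the two large frequencies enter the phase with equal signs. -/
theorem exists_signedSymbol_le {χ₁ χ₂ χ₃ : ℝ² → ℝ} (h₁ : IsAnnular χ₁)
    (h₂ : IsAnnular χ₂) (h₃ : IsAnnular χ₃) {α β γ : ℝ} (hα : α = 1 ∨ α = -1)
    (hβ : β = 1 ∨ β = -1) (hγ : γ = 1 ∨ γ = -1) :
    ∃ C : ℝ, ∀ k₁ k₂ k₃ : ℤ, k₁ ≤ k₂ → k₁ ≤ k₃ →
      ∫ z, ‖FT4 (fun ζ => (signedSymbol χ₁ χ₂ χ₃ α β γ k₁ k₂ k₃ ζ : ℂ)) z‖ ≤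
        C * (2 : ℝ) ^ (-(k₁ : ℝ) / 2) ∧
      (α = γ → ∫ z, ‖FT4 (fun ζ => (signedSymbol χ₁ χ₂ χ₃ α β γ k₁ k₂ k₃ ζ : ℂ)) z‖ ≤
        C * (2 : ℝ) ^ (-(k₂ : ℝ) / 2)) := by
  have hinv : ∀ k : ℤ, ((2 : ℝ) ^ ((k : ℝ) / 2))⁻¹ = (2 : ℝ) ^ (-(k : ℝ) / 2) := fun k => by
    rw [← Real.rpow_neg zero_le_two, neg_div]
  by_cases hαγ : α = γ
  · obtain ⟨C, hC⟩ := (isRegularProfile_of_eq_sign hα hβ).exists_signedSymbol_le h₁ h₂ h₃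
      (α := α) (β := β) (γ := γ) (s := fun _ b => b) (fun _ _ _ hb => hb)
      (fun a b x y ha hb hy => by
        subst hαγ
        field_simp
        ring)
    refine ⟨C, fun k₁ k₂ k₃ h12 h13 => ?_⟩
    have h := hC k₁ k₂ k₃ h12 h13
    simp only [hinv] at h
    refine ⟨h.trans ?_, fun _ => h⟩
    have hC0 : 0 ≤ C := nonneg_of_mul_nonneg_left
      ((integral_nonneg fun _ => norm_nonneg _).trans h) (by positivity)
    gcongr
    exact one_le_two
  · obtain ⟨C, hC⟩ := (isRegularProfile_of_opposite_sign hα hβ).exists_signedSymbol_le h₁ h₂ h₃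
      (α := α) (β := β) (γ := γ) (s := fun a _ => a) (fun _ _ ha _ => ha)
      (fun a b x y ha hb hy => by
        have hγα : γ = -α := by
          rcases hα with rfl | rfl <;> rcases hγ with rfl | rfl <;> simp_all
        have key := sqrt_norm_sub_sqrt_norm (ε := a / b) (x := x) hy
        have hab : b * (a / b) = a := mul_div_cancel₀ a hb.ne'
        rw [hγα]
        dsimp only
        set N := (a / b) * ((2 * ⟪x, y⟫ + (a / b) ^ 2 * ⟪x, x⟫) /
          ((√‖(a / b) ^ 2 • x + y‖ + √‖y‖) * (‖(a / b) ^ 2 • x + y‖ + ‖y‖)))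
        linear_combination α * b * key + α * N * hab)
    refine ⟨C, fun k₁ k₂ k₃ h12 h13 => ⟨?_, fun h => absurd h hαγ⟩⟩
    have h := hC k₁ k₂ k₃ h12 h13
    simpa only [hinv] using h

theorem eventually_signedSymbol_le {χ₁ χ₂ χ₃ : ℝ² → ℝ} (h₁ : IsAnnular χ₁)
    (h₂ : IsAnnular χ₂) (h₃ : IsAnnular χ₃) :
    ∀ᶠ C : ℝ in Filter.atTop, ∀ α ∈ ({1, -1} : Finset ℝ), ∀ β ∈ ({1, -1} : Finset ℝ),
      ∀ γ ∈ ({1, -1} : Finset ℝ), ∀ k₁ k₂ k₃ : ℤ, k₁ ≤ k₂ → k₁ ≤ k₃ →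
      ∫ z, ‖FT4 (fun ζ => (signedSymbol χ₁ χ₂ χ₃ α β γ k₁ k₂ k₃ ζ : ℂ)) z‖ ≤
        C * (2 : ℝ) ^ (-(k₁ : ℝ) / 2) ∧
      (α = γ → ∫ z, ‖FT4 (fun ζ => (signedSymbol χ₁ χ₂ χ₃ α β γ k₁ k₂ k₃ ζ : ℂ)) z‖ ≤
        C * (2 : ℝ) ^ (-(k₂ : ℝ) / 2)) := by
  simp only [Finset.eventually_all]
  intro α hα β hβ γ hγ
  obtain ⟨C₀, hC₀⟩ := exists_signedSymbol_le h₁ h₂ h₃ (by simpa using hα) (by simpa using hβ)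
    (by simpa using hγ)
  filter_upwards [Filter.eventually_ge_atTop C₀] with C hC k₁ k₂ k₃ h12 h13
  obtain ⟨ha, hb⟩ := hC₀ k₁ k₂ k₃ h12 h13
  exact ⟨ha.trans (by gcongr), fun h => (hb h).trans (by gcongr)⟩

theorem isAnnular_LPcut {φ : ℝ² → ℝ} (hφsm : ContDiff ℝ (⊤ : ℕ∞) φ)
    (hφ1 : ∀ ξ ∈ Metric.ball (0 : ℝ²) (3 / 4), φ ξ = 1)
    (hφs : Function.support φ ⊆ Metric.ball (0 : ℝ²) (3 / 2)) : IsAnnular (LPcut φ 0) := by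
  have hL : ∀ x, LPcut φ 0 x = φ x - φ ((2 : ℝ) • x) := fun x => by simp [LPcut]
  refine ⟨?_, fun x hx => ?_⟩
  · rw [funext hL]
    exact hφsm.sub (hφsm.comp (by fun_prop))
  rw [hL] at hx
  constructor <;> by_contra! hlt
  · refine hx ?_
    rw [hφ1 x (by rw [mem_ball_zero_iff]; linarith), hφ1 _ (by
      rw [mem_ball_zero_iff, norm_smul, Real.norm_two]; linarith), sub_self]
  · have hz : ∀ v : ℝ², 3 / 2 < ‖v‖ → φ v = 0 := fun v hv => by
      by_contra h
      have := hφs h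
      rw [mem_ball_zero_iff] at this
      linarith
    refine hx ?_
    rw [hz x hlt, hz _ (by rw [norm_smul, Real.norm_two]; linarith), sub_self]

theorem LPcut_eq (φ : ℝ² → ℝ) (k : ℤ) (ξ : ℝ²) :
    LPcut φ k ξ = LPcut φ 0 ((2 : ℝ) ^ (-k) • ξ) := by
  simp [LPcut, smul_smul, zpow_add₀, mul_comm]

/-- `S^∞` bounds for the Littlewood–Paley localized reciprocal phase `1/Φ_{μν}`
(Lemma `ps-1/F-Soo` (iii) and (iii') of the paper). -/
theorem stmt14 (φ : EuclideanSpace ℝ (Fin 2) → ℝ) (hφsm : ContDiff ℝ (⊤ : ℕ∞) φ)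
    (hφr : ∀ ξ, φ ξ ∈ Set.Icc (0 : ℝ) 1)
    (hφ1 : ∀ ξ ∈ Metric.ball (0 : EuclideanSpace ℝ (Fin 2)) (3 / 4), φ ξ = 1)
    (hφs : Function.support φ ⊆ Metric.ball (0 : EuclideanSpace ℝ (Fin 2)) (3 / 2)) :
    ∃ C : ℝ, 0 < C ∧
      ∀ (k₁ k₂ k₃ : ℤ) (μ ν : ℝ), (μ = 1 ∨ μ = -1) → (ν = 1 ∨ ν = -1) →
        (∫ z : EuclideanSpace ℝ (Fin 2) × EuclideanSpace ℝ (Fin 2),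
            ‖FT4 (fun ζ =>
              ((LPcut φ k₃ (ζ.1 + ζ.2) * (PhiGWW μ ν ζ)⁻¹ *
                (LPcut φ k₁ ζ.1 * LPcut φ k₂ ζ.2) : ℝ) : ℂ)) z‖) ≤
          C * (2 : ℝ) ^ (-((min (min k₁ k₂) k₃ : ℤ) : ℝ) / 2) ∧
        (k₁ ≤ k₂ - 3 → ν = -1 →
          (∫ z : EuclideanSpace ℝ (Fin 2) × EuclideanSpace ℝ (Fin 2),
              ‖FT4 (fun ζ =>
                ((LPcut φ k₃ (ζ.1 + ζ.2) * (PhiGWW μ ν ζ)⁻¹ *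
                  (LPcut φ k₁ ζ.1 * LPcut φ k₂ ζ.2) : ℝ) : ℂ)) z‖) ≤
            C * (2 : ℝ) ^ (-((k₂ : ℤ) : ℝ) / 2)) := by
  have hχ := isAnnular_LPcut hφsm hφ1 hφs
  set χ := LPcut φ 0
  obtain ⟨C, ⟨hC, hC'⟩, hC0⟩ := (((eventually_signedSymbol_le hχ hχ hχ).and
    (eventually_signedSymbol_le hχ hχ.comp_neg hχ)).and (Filter.eventually_gt_atTop 0)).exists
  refine ⟨C, hC0, fun k₁ k₂ k₃ μ ν hμ hν => ?_⟩
  have h1 : (1 : ℝ) ∈ ({1, -1} : Finset ℝ) := by simp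
  have hmem : ∀ σ : ℝ, σ = 1 ∨ σ = -1 → -σ ∈ ({1, -1} : Finset ℝ) := by
    rintro σ (rfl | rfl) <;> simp
  have hsym : ∀ ζ : ℝ² × ℝ², LPcut φ k₃ (ζ.1 + ζ.2) * (PhiGWW μ ν ζ)⁻¹ *
      (LPcut φ k₁ ζ.1 * LPcut φ k₂ ζ.2) = signedSymbol χ χ χ 1 (-μ) (-ν) k₁ k₂ k₃ ζ := fun ζ => by
    rw [LPcut_eq φ k₁, LPcut_eq φ k₂, LPcut_eq φ k₃]
    simp only [signedSymbol, signedPhase, PhiGWW, χ]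
    ring_nf
  simp only [hsym]
  have hswap : ∀ ζ : ℝ² × ℝ², signedSymbol χ χ χ 1 (-μ) (-ν) k₁ k₂ k₃ (ζ.2, ζ.1) =
      signedSymbol χ χ χ 1 (-ν) (-μ) k₂ k₁ k₃ ζ := fun ζ => by
    simp only [signedSymbol, signedPhase, add_comm ζ.2 ζ.1]
    ring
  have hneg : ∀ ζ : ℝ² × ℝ²,
      signedSymbol χ χ χ 1 (-μ) (-ν) k₁ k₂ k₃ (ζ.1 + ζ.2, -ζ.2) =
        signedSymbol χ (fun x => χ (-x)) χ (-μ) 1 (-ν) k₃ k₂ k₁ ζ := fun ζ => by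
    simp only [signedSymbol, signedPhase, add_neg_cancel_right, norm_neg, smul_neg]
    ring
  have h3 : k₃ ≤ k₁ → k₃ ≤ k₂ →
      ∫ z, ‖FT4 (fun ζ => (signedSymbol χ χ χ 1 (-μ) (-ν) k₁ k₂ k₃ ζ : ℂ)) z‖ ≤
        C * (2 : ℝ) ^ (-(k₃ : ℝ) / 2) := fun h31 h32 => by
    rw [← integral_norm_FT4_comp_add_neg]
    simp only [hneg]
    exact (hC' _ (hmem μ hμ) 1 h1 _ (hmem ν hν) k₃ k₂ k₁ h32 h31).1
  constructor
  · rcases le_total k₁ k₂ with h12 | h12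
    · rcases le_total k₁ k₃ with h13 | h13
      · rw [min_eq_left h12, min_eq_left h13]
        exact (hC 1 h1 _ (hmem μ hμ) _ (hmem ν hν) k₁ k₂ k₃ h12 h13).1
      · rw [min_eq_left h12, min_eq_right h13]
        exact h3 h13 (h13.trans h12)
    · rcases le_total k₂ k₃ with h23 | h23
      · rw [min_eq_right h12, min_eq_left h23, ← integral_norm_FT4_comp_swap]
        simp only [hswap]
        exact (hC 1 h1 _ (hmem ν hν) _ (hmem μ hμ) k₂ k₁ k₃ h12 h23).1
      · rw [min_eq_right h12, min_eq_right h23]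
        exact h3 (h23.trans h12) h23
  · rintro h12 rfl
    by_cases hzero : ∀ ζ, signedSymbol χ χ χ 1 (-μ) (- -1) k₁ k₂ k₃ ζ = 0
    · rw [integral_norm_FT4_eq_zero fun p => by rw [hzero p, Complex.ofReal_zero]]
      positivity
    push Not at hzero
    obtain ⟨p, hp⟩ := hzero
    have h := signedSymbol_ne_zero hχ hχ hχ hp
    have h8 : (2 : ℝ) ^ k₁ ≤ 2 ^ k₂ / 8 := by
      refine (zpow_le_zpow_right₀ one_le_two h12).trans_eq ?_
      rw [zpow_sub₀ two_ne_zero]; norm_num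
    have h13 : k₁ ≤ k₃ := by
      rw [← zpow_le_zpow_iff_right₀ (one_lt_two : (1 : ℝ) < 2)]
      linarith
    exact (hC 1 h1 _ (hmem μ hμ) _ (hmem _ hν) k₁ k₂ k₃ (by omega) h13).2 (by norm_num)

end
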